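/- arXiv:2302.07630 — 7 statements merged into one kernel-verified Lean document; each statement's English description precedes it below -/
import Mathlib

section
/- Let V be a real normed vector space, H a real Hilbert space, ι : V → H a continuous linear map with operator norm ‖ι‖, and a : V × V → ℝ a continuous bilinear form satisfying the coercivity condition a(v,v) ≥ α‖v‖²_V for all v ∈ V, where α > 0. Let T > 0, let y : ℝ → V be continuously differentiable with derivative y', let u : ℝ → H be continuous, and assume that for every t ∈ [0,T] and every v ∈ V: ⟨ι(y'(t)), ι(v)⟩_H + a(y(t), v) = ⟨u(t), ι(v)⟩_H. Then ∫₀ᵀ ‖y(t)‖²_V dt ≤ (‖ι‖²/α²) ∫₀ᵀ ‖u(t)‖²_H dt + (1/α) ‖ι(y(0))‖²_H. -/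
open MeasureTheory RealInnerProductSpace

theorem stmt3 {V : Type*} [NormedAddCommGroup V] [NormedSpace ℝ V]
    {H : Type*} [NormedAddCommGroup H] [InnerProductSpace ℝ H] [CompleteSpace H]
    (ι : V →L[ℝ] H) (a : V →L[ℝ] V →L[ℝ] ℝ) (α : ℝ) (hα : 0 < α)
    (hcoer : ∀ v : V, α * ‖v‖ ^ 2 ≤ a v v)
    (T : ℝ) (hT : 0 < T) (y y' : ℝ → V) (u : ℝ → H)
    (hy : ContDiff ℝ 1 y) (hy' : ∀ t, HasDerivAt y (y' t) t) (hu : Continuous u)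
    (heq : ∀ t ∈ Set.Icc (0 : ℝ) T, ∀ v : V,
      ⟪ι (y' t), ι v⟫ + a (y t) v = ⟪u t, ι v⟫) :
    (∫ t in (0 : ℝ)..T, ‖y t‖ ^ 2) ≤
      (‖ι‖ ^ 2 / α ^ 2) * (∫ t in (0 : ℝ)..T, ‖u t‖ ^ 2) + (1 / α) * ‖ι (y 0)‖ ^ 2 := by
  have hy'c : Continuous y' := by
    have h : deriv y = y' := funext fun t => (hy' t).deriv
    exact h ▸ hy.continuous_deriv le_rfl
  have hyc : Continuous y := hy.continuous
  have hE : ∀ t, HasDerivAt (fun s => ‖ι (y s)‖ ^ 2) (2 * ⟪ι (y t), ι (y' t)⟫) t := fun t =>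
    (ι.hasFDerivAt.comp_hasDerivAt t (hy' t)).norm_sq
  have hEc : Continuous fun t => 2 * ⟪ι (y t), ι (y' t)⟫ := by fun_prop
  have hyi : IntervalIntegrable (fun t => α * ‖y t‖ ^ 2) volume 0 T :=
    Continuous.intervalIntegrable (by fun_prop) 0 T
  have hui : IntervalIntegrable (fun t => ‖ι‖ ^ 2 / α * ‖u t‖ ^ 2) volume 0 T :=
    Continuous.intervalIntegrable (by fun_prop) 0 T
  have henergy : (∫ t in (0 : ℝ)..T, 2 * ⟪ι (y t), ι (y' t)⟫) = ‖ι (y T)‖ ^ 2 - ‖ι (y 0)‖ ^ 2 :=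
    intervalIntegral.integral_eq_sub_of_hasDerivAt (fun t _ => hE t) (hEc.intervalIntegrable 0 T)
  have hmono := intervalIntegral.integral_mono_on hT.le
    (hyi.add (hEc.intervalIntegrable 0 T)) hui fun t ht => by
      have hpair : ⟪u t, ι (y t)⟫ ≤ ‖u t‖ * (‖ι‖ * ‖y t‖) :=
        (real_inner_le_norm _ _).trans (by gcongr; exact ι.le_opNorm _)
      have hyoung : 2 * (‖u t‖ * (‖ι‖ * ‖y t‖)) ≤ ‖ι‖ ^ 2 / α * ‖u t‖ ^ 2 + α * ‖y t‖ ^ 2 := by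
        have h : 0 ≤ (‖ι‖ * ‖u t‖ - α * ‖y t‖) ^ 2 / α := by positivity
        have h_expand : (‖ι‖ * ‖u t‖ - α * ‖y t‖) ^ 2 / α =
            ‖ι‖ ^ 2 / α * ‖u t‖ ^ 2 + α * ‖y t‖ ^ 2 - 2 * (‖u t‖ * (‖ι‖ * ‖y t‖)) := by
          field_simp
          ring
        linarith
      have htest := heq t ht (y t)
      rw [real_inner_comm] at htest
      linarith [hcoer (y t)]
  rw [intervalIntegral.integral_add hyi (hEc.intervalIntegrable 0 T), henergy,
    intervalIntegral.integral_const_mul, intervalIntegral.integral_const_mul] at hmono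
  refine le_of_mul_le_mul_left ?_ hα
  have h_scale : ∀ I : ℝ, α * (‖ι‖ ^ 2 / α ^ 2 * I + 1 / α * ‖ι (y 0)‖ ^ 2) =
      ‖ι‖ ^ 2 / α * I + ‖ι (y 0)‖ ^ 2 := fun I => by
    field_simp
  rw [h_scale]
  linarith [sq_nonneg ‖ι (y T)‖]
end

section
/- Let V be a real normed vector space, H a real Hilbert space, ι : V → H a continuous linear map, and a : V × V → ℝ a continuous symmetric bilinear form. Let τ > 0, T > 0, let y : ℝ → V be twice continuously differentiable with derivatives y', y'', let u : ℝ → H be continuous, and assume that for every t ∈ [0,T] and every v ∈ V: τ⟨ι(y''(t)), ι(v)⟩_H + ⟨ι(y'(t)), ι(v)⟩_H + a(y(t), v) = ⟨u(t), ι(v)⟩_H. Then the energy identity holds: (τ/2)‖ι(y'(T))‖²_H + (1/2) a(y(T), y(T)) + ∫₀ᵀ ‖ι(y'(t))‖²_H dt = (τ/2)‖ι(y'(0))‖²_H + (1/2) a(y(0), y(0)) + ∫₀ᵀ ⟨u(t), ι(y'(t))⟩_H dt. -/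
open MeasureTheory RealInnerProductSpace

theorem stmt4 {V : Type*} [NormedAddCommGroup V] [NormedSpace ℝ V]
    {H : Type*} [NormedAddCommGroup H] [InnerProductSpace ℝ H] [CompleteSpace H]
    (ι : V →L[ℝ] H) (a : V →L[ℝ] V →L[ℝ] ℝ)
    (hsymm : ∀ v w : V, a v w = a w v)
    (τ T : ℝ) (hτ : 0 < τ) (hT : 0 < T) (y y' y'' : ℝ → V) (u : ℝ → H)
    (hy : ContDiff ℝ 2 y) (hy' : ∀ t, HasDerivAt y (y' t) t)
    (hy'' : ∀ t, HasDerivAt y' (y'' t) t) (hu : Continuous u)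
    (heq : ∀ t ∈ Set.Icc (0 : ℝ) T, ∀ v : V,
      τ * ⟪ι (y'' t), ι v⟫ + ⟪ι (y' t), ι v⟫ + a (y t) v = ⟪u t, ι v⟫) :
    τ / 2 * ‖ι (y' T)‖ ^ 2 + 1 / 2 * a (y T) (y T)
        + (∫ t in (0 : ℝ)..T, ‖ι (y' t)‖ ^ 2) =
      τ / 2 * ‖ι (y' 0)‖ ^ 2 + 1 / 2 * a (y 0) (y 0)
        + ∫ t in (0 : ℝ)..T, ⟪u t, ι (y' t)⟫ := by
  have hy'c : Continuous y' := continuous_iff_continuousAt.2 fun t => (hy'' t).continuousAt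
  have hιc : Continuous fun t => ι (y' t) := ι.continuous.comp hy'c
  have hderiv : ∀ t ∈ Set.uIcc (0 : ℝ) T,
      HasDerivAt (fun s => τ / 2 * ‖ι (y' s)‖ ^ 2 + 1 / 2 * a (y s) (y s))
        (⟪u t, ι (y' t)⟫ - ‖ι (y' t)‖ ^ 2) t := by
    intro t ht
    rw [Set.uIcc_of_le hT.le] at ht
    have hkin : HasDerivAt (fun s => ‖ι (y' s)‖ ^ 2) (2 * ⟪ι (y' t), ι (y'' t)⟫) t :=
      (ι.hasFDerivAt.comp_hasDerivAt t (hy'' t)).norm_sq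
    have hpot : HasDerivAt (fun s => a (y s) (y s)) (a (y' t) (y t) + a (y t) (y' t)) t :=
      (a.hasFDerivAt.comp_hasDerivAt t (hy' t)).clm_apply (hy' t)
    refine ((hkin.const_mul (τ / 2)).add (hpot.const_mul (1 / 2))).congr_deriv ?_
    have h := heq t ht (y' t)
    rw [real_inner_self_eq_norm_sq] at h
    rw [← h, hsymm (y' t) (y t), real_inner_comm (ι (y'' t)) (ι (y' t))]
    ring
  have hwork : Continuous fun t => ⟪u t, ι (y' t)⟫ := hu.inner hιc
  have hdiss : Continuous fun t => ‖ι (y' t)‖ ^ 2 := hιc.norm.pow 2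
  have hint := intervalIntegral.integral_eq_sub_of_hasDerivAt hderiv
    ((hwork.sub hdiss).intervalIntegrable 0 T)
  rw [intervalIntegral.integral_sub (hwork.intervalIntegrable 0 T)
    (hdiss.intervalIntegrable 0 T)] at hint
  linarith
end

section
/- Let V be a real normed vector space, H a real Hilbert space, ι : V → H a continuous linear map, and a : V × V → ℝ a continuous symmetric bilinear form with a(v,v) ≥ 0 for all v ∈ V. Let τ > 0, T > 0, let y : ℝ → V be twice continuously differentiable with derivatives y', y'', let u : ℝ → H be continuous, and assume that for every t ∈ [0,T] and every v ∈ V: τ⟨ι(y''(t)), ι(v)⟩_H + ⟨ι(y'(t)), ι(v)⟩_H + a(y(t), v) = ⟨u(t), ι(v)⟩_H. Then ∫₀ᵀ ‖ι(y'(t))‖²_H dt ≤ ∫₀ᵀ ‖u(t)‖²_H dt + τ‖ι(y'(0))‖²_H + a(y(0), y(0)). In particular the bound on the time derivative of the solution is uniform in τ on bounded sets of τ. -/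
open MeasureTheory RealInnerProductSpace

theorem stmt5 {V : Type*} [NormedAddCommGroup V] [NormedSpace ℝ V]
    {H : Type*} [NormedAddCommGroup H] [InnerProductSpace ℝ H] [CompleteSpace H]
    (ι : V →L[ℝ] H) (a : V →L[ℝ] V →L[ℝ] ℝ)
    (hsymm : ∀ v w : V, a v w = a w v) (hpos : ∀ v : V, 0 ≤ a v v)
    (τ T : ℝ) (hτ : 0 < τ) (hT : 0 < T) (y y' y'' : ℝ → V) (u : ℝ → H)
    (hy : ContDiff ℝ 2 y) (hy' : ∀ t, HasDerivAt y (y' t) t)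
    (hy'' : ∀ t, HasDerivAt y' (y'' t) t) (hu : Continuous u)
    (heq : ∀ t ∈ Set.Icc (0 : ℝ) T, ∀ v : V,
      τ * ⟪ι (y'' t), ι v⟫ + ⟪ι (y' t), ι v⟫ + a (y t) v = ⟪u t, ι v⟫) :
    (∫ t in (0 : ℝ)..T, ‖ι (y' t)‖ ^ 2) ≤
      (∫ t in (0 : ℝ)..T, ‖u t‖ ^ 2) + τ * ‖ι (y' 0)‖ ^ 2 + a (y 0) (y 0) := by
  have hιy' : ∀ t, HasDerivAt (fun t ↦ ι (y' t)) (ι (y'' t)) t :=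
    fun t ↦ ι.hasFDerivAt.comp_hasDerivAt t (hy'' t)
  have hE : ∀ t, HasDerivAt (fun t ↦ τ * ‖ι (y' t)‖ ^ 2 + a (y t) (y t))
      (τ * (2 * ⟪ι (y' t), ι (y'' t)⟫) + (a (y' t) (y t) + a (y t) (y' t))) t :=
    fun t ↦ ((hιy' t).norm_sq.const_mul τ).add
      ((a.hasFDerivAt.comp_hasDerivAt t (hy' t)).clm_apply (hy' t))
  have hcont : Continuous fun t ↦ ‖ι (y' t)‖ ^ 2 :=
    (continuous_iff_continuousAt.2 fun t ↦ (hιy' t).continuousAt).norm.pow 2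
  have hucont : Continuous fun t ↦ ‖u t‖ ^ 2 := hu.norm.pow 2
  have hdissip : ∀ t ∈ Set.Ioo 0 T,
      τ * (2 * ⟪ι (y' t), ι (y'' t)⟫) + (a (y' t) (y t) + a (y t) (y' t)) ≤
        ‖u t‖ ^ 2 - ‖ι (y' t)‖ ^ 2 := by
    intro t ht
    have h := heq t (Set.Ioo_subset_Icc_self ht) (y' t)
    have hsq := norm_sub_sq_real (u t) (ι (y' t))
    rw [real_inner_self_eq_norm_sq, real_inner_comm] at h
    rw [hsymm (y' t) (y t)]
    linarith [sq_nonneg ‖u t - ι (y' t)‖]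
  have hmain := intervalIntegral.sub_le_integral_of_hasDeriv_right_of_le hT.le
    (fun t _ ↦ (hE t).continuousAt.continuousWithinAt)
    (fun t _ ↦ (hE t).hasDerivWithinAt)
    (hucont.sub hcont).continuousOn.integrableOn_Icc hdissip
  simp only [Pi.sub_apply] at hmain
  rw [intervalIntegral.integral_sub (hucont.intervalIntegrable 0 T)
    (hcont.intervalIntegrable 0 T)] at hmain
  have hfinal : 0 ≤ τ * ‖ι (y' T)‖ ^ 2 := by positivity
  linarith [hpos (y T)]
end

section
/- Let T > 0, α > 0, M ≥ 0 and Cι ≥ 0 be real numbers. There exists a constant C > 0, depending only on T, α, M and Cι, with the following property. Let V be a real normed vector space, H a real Hilbert space, ι : V → H a continuous linear map with ‖ι(v)‖_H ≤ Cι ‖v‖_V for all v ∈ V, and a : V × V → ℝ a symmetric bilinear form with |a(v,w)| ≤ M‖v‖_V ‖w‖_V and a(v,v) ≥ α‖v‖²_V for all v, w ∈ V. Then for every τ ∈ (0,1], every twice continuously differentiable y : ℝ → V and every continuous u : ℝ → H such that for all t ∈ [0,T] and all v ∈ V: τ⟨ι(y''(t)), ι(v)⟩_H + ⟨ι(y'(t)),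 ι(v)⟩_H + a(y(t), v) = ⟨u(t), ι(v)⟩_H, one has ∫₀ᵀ ‖y(t)‖²_V dt + ∫₀ᵀ ‖ι(y'(t))‖²_H dt ≤ C ( ∫₀ᵀ ‖u(t)‖²_H dt + ‖y(0)‖²_V + ‖ι(y'(0))‖²_H ). -/
open MeasureTheory RealInnerProductSpace

universe u v

/-- If `E` is differentiable and `E' ≤ f - g` on `[0, T]`, then
`E t + ∫₀ᵗ g ≤ E 0 + ∫₀ᵗ f` for `t ∈ [0, T]`. -/
theorem add_integral_le_of_hasDerivAt_le {T : ℝ} {E E' f g : ℝ → ℝ}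
    (hf : Continuous f) (hg : Continuous g) (hE : ∀ t, HasDerivAt E (E' t) t)
    (hle : ∀ t ∈ Set.Icc (0 : ℝ) T, E' t ≤ f t - g t) {t : ℝ} (ht : t ∈ Set.Icc (0 : ℝ) T) :
    E t + ∫ s in (0 : ℝ)..t, g s ≤ E 0 + ∫ s in (0 : ℝ)..t, f s := by
  have hD (s : ℝ) : HasDerivAt
      (fun s => E s + (∫ r in (0 : ℝ)..s, g r) - ∫ r in (0 : ℝ)..s, f r)
      (E' s + g s - f s) s :=
    ((hE s).add (hg.integral_hasStrictDerivAt 0 s).hasDerivAt).sub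
      (hf.integral_hasStrictDerivAt 0 s).hasDerivAt
  have hanti := antitoneOn_of_hasDerivWithinAt_nonpos (convex_Icc (0 : ℝ) T)
    (fun s _ => (hD s).continuousAt.continuousWithinAt)
    (fun s _ => (hD s).hasDerivWithinAt)
    (fun s hs => by linarith [hle s (interior_subset hs)])
  have := hanti (Set.left_mem_Icc.2 (ht.1.trans ht.2)) ht ht.1
  simp only [intervalIntegral.integral_same] at this
  linarith

/-- The derivative of the energy `τ ‖ι y'‖² + a(y, y)` along a differentiable curve. -/
theorem hasDerivAt_cattaneo_energy {V : Type u} {H : Type v}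
    [NormedAddCommGroup V] [NormedSpace ℝ V] [NormedAddCommGroup H] [InnerProductSpace ℝ H]
    (ι : V →L[ℝ] H) (a : V →ₗ[ℝ] V →ₗ[ℝ] ℝ) {M : ℝ}
    (hsymm : ∀ v w : V, a v w = a w v) (hbound : ∀ v w : V, |a v w| ≤ M * ‖v‖ * ‖w‖)
    (τ : ℝ) {y y' y'' : ℝ → V} {t : ℝ}
    (hy : HasDerivAt y (y' t) t) (hy' : HasDerivAt y' (y'' t) t) :
    HasDerivAt (fun s => τ * ‖ι (y' s)‖ ^ 2 + a (y s) (y s))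
      (2 * (τ * ⟪ι (y'' t), ι (y' t)⟫ + a (y t) (y' t))) t := by
  have h1 := (ι.hasFDerivAt.comp_hasDerivAt t hy').norm_sq
  have h2 := (LinearMap.mkContinuous₂ a M hbound).hasDerivAt_of_bilinear (fun _ => hy) (fun _ => hy)
  simp only [LinearMap.mkContinuous₂_apply] at h2
  refine ((h1.const_mul τ).add h2).congr_deriv ?_
  rw [hsymm (y' t) (y t), real_inner_comm]
  simp only [Function.comp_apply]
  ring

theorem stmt6 (T α M Cι : ℝ) (hT : 0 < T) (hα : 0 < α) (hM : 0 ≤ M) (hCι : 0 ≤ Cι) :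
    ∃ C : ℝ, 0 < C ∧
      ∀ (V : Type u) (H : Type v) [NormedAddCommGroup V] [NormedSpace ℝ V]
        [NormedAddCommGroup H] [InnerProductSpace ℝ H] [CompleteSpace H]
        (ι : V →L[ℝ] H) (a : V →ₗ[ℝ] V →ₗ[ℝ] ℝ),
        (∀ v : V, ‖ι v‖ ≤ Cι * ‖v‖) →
        (∀ v w : V, a v w = a w v) →
        (∀ v w : V, |a v w| ≤ M * ‖v‖ * ‖w‖) →
        (∀ v : V, α * ‖v‖ ^ 2 ≤ a v v) →
        ∀ (τ : ℝ), τ ∈ Set.Ioc (0 : ℝ) 1 →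
        ∀ (y y' y'' : ℝ → V) (u : ℝ → H),
        ContDiff ℝ 2 y → (∀ t, HasDerivAt y (y' t) t) → (∀ t, HasDerivAt y' (y'' t) t) →
        Continuous u →
        (∀ t ∈ Set.Icc (0 : ℝ) T, ∀ v : V,
          τ * ⟪ι (y'' t), ι v⟫ + ⟪ι (y' t), ι v⟫ + a (y t) v = ⟪u t, ι v⟫) →
        (∫ t in (0 : ℝ)..T, ‖y t‖ ^ 2) + (∫ t in (0 : ℝ)..T, ‖ι (y' t)‖ ^ 2) ≤
          C * ((∫ t in (0 : ℝ)..T, ‖u t‖ ^ 2) + ‖y 0‖ ^ 2 + ‖ι (y' 0)‖ ^ 2) := by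
  refine ⟨(T / α + 1) * (1 + M), by positivity, ?_⟩
  intro V H _ _ _ _ _ ι a _ hsymm hbound hcoer τ hτ y y' y'' u _ hy hy' hu heq
  have hyc : Continuous y := continuous_iff_continuousAt.2 fun t => (hy t).continuousAt
  have hyc' : Continuous y' := continuous_iff_continuousAt.2 fun t => (hy' t).continuousAt
  have hf : Continuous fun t => ‖u t‖ ^ 2 := by fun_prop
  have hg : Continuous fun t => ‖ι (y' t)‖ ^ 2 := by fun_prop
  have henergy {t : ℝ} (ht : t ∈ Set.Icc (0 : ℝ) T) :=
    add_integral_le_of_hasDerivAt_le hf hg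
      (fun t => hasDerivAt_cattaneo_energy ι a hsymm hbound τ (hy t) (hy' t))
      (fun t ht => by
        have h1 := heq t ht (y' t)
        have h2 := norm_sub_sq_real (u t) (ι (y' t))
        rw [real_inner_self_eq_norm_sq] at h1
        nlinarith [sq_nonneg ‖u t - ι (y' t)‖]) ht
  set D := (∫ t in (0 : ℝ)..T, ‖u t‖ ^ 2) + ‖y 0‖ ^ 2 + ‖ι (y' 0)‖ ^ 2 with hD
  have hu0 : 0 ≤ ∫ t in (0 : ℝ)..T, ‖u t‖ ^ 2 :=
    intervalIntegral.integral_nonneg hT.le fun t _ => sq_nonneg _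
  have hinit : τ * ‖ι (y' 0)‖ ^ 2 + a (y 0) (y 0) + (∫ t in (0 : ℝ)..T, ‖u t‖ ^ 2)
      ≤ (1 + M) * D := by
    have h1 := (le_abs_self _).trans (hbound (y 0) (y 0))
    have h2 := mul_le_mul_of_nonneg_right hτ.2 (sq_nonneg ‖ι (y' 0)‖)
    have h3 := mul_nonneg hM hu0
    have h4 := mul_nonneg hM (sq_nonneg ‖ι (y' 0)‖)
    rw [hD]
    nlinarith [sq_nonneg ‖y 0‖]
  have hpoint : ∀ t ∈ Set.Icc (0 : ℝ) T, ‖y t‖ ^ 2 ≤ (1 + M) * D / α := by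
    intro t ht
    have h1 := henergy ht
    have h2 : 0 ≤ ∫ s in (0 : ℝ)..t, ‖ι (y' s)‖ ^ 2 :=
      intervalIntegral.integral_nonneg ht.1 fun s _ => sq_nonneg _
    have h3 : (∫ s in (0 : ℝ)..t, ‖u s‖ ^ 2) ≤ ∫ s in (0 : ℝ)..T, ‖u s‖ ^ 2 :=
      intervalIntegral.integral_mono_interval le_rfl ht.1 ht.2
        (Filter.Eventually.of_forall fun s => sq_nonneg _) (hf.intervalIntegrable 0 T)
    have h4 := mul_nonneg hτ.1.le (sq_nonneg ‖ι (y' t)‖)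
    rw [le_div_iff₀ hα]
    linarith [hcoer (y t)]
  have hposition : (∫ t in (0 : ℝ)..T, ‖y t‖ ^ 2) ≤ T * ((1 + M) * D / α) := by
    have h1 := intervalIntegral.integral_mono_on (μ := volume) hT.le
      ((hyc.norm.pow 2).intervalIntegrable 0 T)
      (continuous_const.intervalIntegrable 0 T) hpoint
    rwa [intervalIntegral.integral_const, sub_zero, smul_eq_mul] at h1
  have hvelocity : (∫ t in (0 : ℝ)..T, ‖ι (y' t)‖ ^ 2) ≤ (1 + M) * D := by
    have h1 := henergy (Set.right_mem_Icc.2 hT.le)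
    have h2 := mul_nonneg hτ.1.le (sq_nonneg ‖ι (y' T)‖)
    have h3 := mul_nonneg hα.le (sq_nonneg ‖y T‖)
    linarith [hcoer (y T)]
  calc _ ≤ T * ((1 + M) * D / α) + (1 + M) * D := add_le_add hposition hvelocity
    _ = _ := by ring
end

section
/- Let V be a real normed vector space, H a real Hilbert space, ι : V → H a continuous linear map with operator norm ‖ι‖, and a : V × V → ℝ a continuous bilinear form with a(v,v) ≥ α‖v‖²_V for all v ∈ V, where α > 0. Let τ > 0 and T > 0. Let y₁ : ℝ → V be twice continuously differentiable and u₁ : ℝ → H continuous with: τ⟨ι(y₁''(t)), ι(v)⟩_H + ⟨ι(y₁'(t)), ι(v)⟩_H + a(y₁(t), v) = ⟨u₁(t), ι(v)⟩_H for all t ∈ [0,T], v ∈ V. Let y₂ : ℝ → V be continuously differentiable and u₂ : ℝ → H continuous with: ⟨ι(y₂'(t)), ι(v)⟩_H + a(y₂(t), v) = ⟨u₂(t), ι(v)⟩_H for all t ∈ [0,T], v ∈ V. Assume y₁(0) = y₂(0). Then (∫₀ᵀ ‖y₁(t) − y₂(t)‖²_V dt)^{1/2} ≤ (‖ι‖/α)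 [ (∫₀ᵀ ‖u₁(t) − u₂(t)‖²_H dt)^{1/2} + τ (∫₀ᵀ ‖ι(y₁''(t))‖²_H dt)^{1/2} ]. -/
open MeasureTheory RealInnerProductSpace

/-- The Cauchy–Schwarz inequality for nonnegative continuous functions on an interval. -/
theorem intervalIntegral_mul_le_sqrt_mul_sqrt {f g : ℝ → ℝ} (hf : Continuous f)
    (hg : Continuous g) (hf0 : 0 ≤ f) (hg0 : 0 ≤ g) {a b : ℝ} (hab : a ≤ b) :
    ∫ t in a..b, f t * g t ≤
      Real.sqrt (∫ t in a..b, f t ^ 2) * Real.sqrt (∫ t in a..b, g t ^ 2) := by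
  have memLp_two {h : ℝ → ℝ} (hh : Continuous h) :
      MemLp h (ENNReal.ofReal 2) (volume.restrict (Set.Ioc a b)) := by
    rw [ENNReal.ofReal_ofNat, memLp_two_iff_integrable_sq hh.aestronglyMeasurable]
    exact ((hh.pow 2).integrableOn_Icc).mono_set Set.Ioc_subset_Icc_self
  have holder := integral_mul_le_Lp_mul_Lq_of_nonneg Real.HolderConjugate.two_two
    (Filter.Eventually.of_forall hf0) (Filter.Eventually.of_forall hg0)
    (memLp_two hf) (memLp_two hg)
  simpa only [intervalIntegral.integral_of_le hab, Real.sqrt_eq_rpow, Real.rpow_ofNat]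
    using holder

theorem stmt7 {V : Type*} [NormedAddCommGroup V] [NormedSpace ℝ V]
    {H : Type*} [NormedAddCommGroup H] [InnerProductSpace ℝ H] [CompleteSpace H]
    (ι : V →L[ℝ] H) (a : V →L[ℝ] V →L[ℝ] ℝ) (α : ℝ) (hα : 0 < α)
    (hcoer : ∀ v : V, α * ‖v‖ ^ 2 ≤ a v v)
    (τ T : ℝ) (hτ : 0 < τ) (hT : 0 < T)
    (y₁ y₁' y₁'' : ℝ → V) (u₁ : ℝ → H)
    (hy₁ : ContDiff ℝ 2 y₁) (hy₁' : ∀ t, HasDerivAt y₁ (y₁' t) t)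
    (hy₁'' : ∀ t, HasDerivAt y₁' (y₁'' t) t) (hu₁ : Continuous u₁)
    (heq₁ : ∀ t ∈ Set.Icc (0 : ℝ) T, ∀ v : V,
      τ * ⟪ι (y₁'' t), ι v⟫ + ⟪ι (y₁' t), ι v⟫ + a (y₁ t) v = ⟪u₁ t, ι v⟫)
    (y₂ y₂' : ℝ → V) (u₂ : ℝ → H)
    (hy₂ : ContDiff ℝ 1 y₂) (hy₂' : ∀ t, HasDerivAt y₂ (y₂' t) t) (hu₂ : Continuous u₂)
    (heq₂ : ∀ t ∈ Set.Icc (0 : ℝ) T, ∀ v : V,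
      ⟪ι (y₂' t), ι v⟫ + a (y₂ t) v = ⟪u₂ t, ι v⟫)
    (hinit : y₁ 0 = y₂ 0) :
    Real.sqrt (∫ t in (0 : ℝ)..T, ‖y₁ t - y₂ t‖ ^ 2) ≤
      (‖ι‖ / α) * (Real.sqrt (∫ t in (0 : ℝ)..T, ‖u₁ t - u₂ t‖ ^ 2)
        + τ * Real.sqrt (∫ t in (0 : ℝ)..T, ‖ι (y₁'' t)‖ ^ 2)) := by
  have cy₁' : Continuous y₁' := by
    rw [← (funext fun t => (hy₁' t).deriv : deriv y₁ = y₁')]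
    exact hy₁.continuous_deriv (by norm_num)
  have cy₁'' : Continuous y₁'' := by
    rw [← (funext fun t => (hy₁'' t).deriv : deriv y₁' = y₁''),
      ← (funext fun t => (hy₁' t).deriv : deriv y₁ = y₁')]
    exact (ContDiff.deriv' (n := 1) hy₁).continuous_deriv le_rfl
  have cy₂' : Continuous y₂' := by
    rw [← (funext fun t => (hy₂' t).deriv : deriv y₂ = y₂')]
    exact hy₂.continuous_deriv le_rfl
  have cy₁ := hy₁.continuous
  have cy₂ := hy₂.continuous
  have energy_deriv (t : ℝ) : HasDerivAt (fun t => ‖ι (y₁ t - y₂ t)‖ ^ 2)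
      (2 * ⟪ι (y₁ t - y₂ t), ι (y₁' t - y₂' t)⟫) t :=
    (ι.hasFDerivAt.comp_hasDerivAt t ((hy₁' t).sub (hy₂' t))).norm_sq
  have energy_nonneg :
      0 ≤ ∫ t in (0 : ℝ)..T, ⟪ι (y₁ t - y₂ t), ι (y₁' t - y₂' t)⟫ := by
    have ftc := intervalIntegral.integral_eq_sub_of_hasDerivAt (a := 0) (b := T)
      (fun t _ => energy_deriv t) (Continuous.intervalIntegrable (by fun_prop) _ _)
    rw [intervalIntegral.integral_const_mul, hinit, sub_self, map_zero, norm_zero] at ftc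
    linarith [sq_nonneg ‖ι (y₁ T - y₂ T)‖]
  have pointwise (t : ℝ) (ht : t ∈ Set.Icc 0 T) :
      α * ‖y₁ t - y₂ t‖ ^ 2 + ⟪ι (y₁ t - y₂ t), ι (y₁' t - y₂' t)⟫ ≤
        ‖ι‖ * (‖u₁ t - u₂ t‖ * ‖y₁ t - y₂ t‖ + τ * (‖ι (y₁'' t)‖ * ‖y₁ t - y₂ t‖)) := by
    have coer := hcoer (y₁ t - y₂ t)
    have eq₁ := heq₁ t ht (y₁ t - y₂ t)
    have eq₂ := heq₂ t ht (y₁ t - y₂ t)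
    have bound (h : H) : |⟪h, ι (y₁ t - y₂ t)⟫| ≤ ‖ι‖ * (‖h‖ * ‖y₁ t - y₂ t‖) := by
      calc _ ≤ ‖h‖ * ‖ι (y₁ t - y₂ t)‖ := abs_real_inner_le_norm _ _
        _ ≤ ‖h‖ * (‖ι‖ * ‖y₁ t - y₂ t‖) := by gcongr; exact ι.le_opNorm _
        _ = _ := by ring
    have source := (abs_le.mp (bound (u₁ t - u₂ t))).2
    have inertia := mul_le_mul_of_nonneg_left (abs_le.mp (bound (ι (y₁'' t)))).1 hτ.le
    rw [inner_sub_left] at source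
    have split : a (y₁ t - y₂ t) (y₁ t - y₂ t) =
        a (y₁ t) (y₁ t - y₂ t) - a (y₂ t) (y₁ t - y₂ t) := by
      rw [map_sub a, sub_apply]
    rw [real_inner_comm, map_sub ι (y₁' t), inner_sub_left]
    linarith
  have integrated := intervalIntegral.integral_mono_on (μ := volume) hT.le
    (Continuous.intervalIntegrable (by fun_prop) _ _)
    (Continuous.intervalIntegrable (by fun_prop) _ _) pointwise
  rw [intervalIntegral.integral_add (Continuous.intervalIntegrable (by fun_prop) _ _)
      (Continuous.intervalIntegrable (by fun_prop) _ _),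
    intervalIntegral.integral_const_mul, intervalIntegral.integral_const_mul,
    intervalIntegral.integral_add (Continuous.intervalIntegrable (by fun_prop) _ _)
      (Continuous.intervalIntegrable (by fun_prop) _ _),
    intervalIntegral.integral_const_mul] at integrated
  have source_le := intervalIntegral_mul_le_sqrt_mul_sqrt (hu₁.sub hu₂).norm
    (cy₁.sub cy₂).norm (fun _ => norm_nonneg _) (fun _ => norm_nonneg _) hT.le
  have inertia_le := intervalIntegral_mul_le_sqrt_mul_sqrt (ι.continuous.comp cy₁'').norm
    (cy₁.sub cy₂).norm (fun _ => norm_nonneg _) (fun _ => norm_nonneg _) hT.le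
  simp only [Pi.sub_apply, Function.comp_apply] at source_le inertia_le
  have sq_error : Real.sqrt (∫ t in (0 : ℝ)..T, ‖y₁ t - y₂ t‖ ^ 2) ^ 2 =
      ∫ t in (0 : ℝ)..T, ‖y₁ t - y₂ t‖ ^ 2 :=
    Real.sq_sqrt (intervalIntegral.integral_nonneg hT.le fun _ _ => sq_nonneg _)
  rw [← sq_error] at integrated
  set E := Real.sqrt (∫ t in (0 : ℝ)..T, ‖y₁ t - y₂ t‖ ^ 2)
  set P := Real.sqrt (∫ t in (0 : ℝ)..T, ‖u₁ t - u₂ t‖ ^ 2)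
  set Q := Real.sqrt (∫ t in (0 : ℝ)..T, ‖ι (y₁'' t)‖ ^ 2)
  have hE : 0 ≤ E := Real.sqrt_nonneg _
  have hP : 0 ≤ P := Real.sqrt_nonneg _
  have hQ : 0 ≤ Q := Real.sqrt_nonneg _
  have key : α * E ^ 2 ≤ ‖ι‖ * (P * E + τ * (Q * E)) := by
    calc α * E ^ 2 ≤ _ := (le_add_of_nonneg_right (by positivity)).trans integrated
      _ ≤ _ := by gcongr
  rcases hE.eq_or_lt with hE₀ | hE₀
  · rw [← hE₀]
    positivity
  · rw [div_mul_eq_mul_div, le_div_iff₀ hα]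
    exact le_of_mul_le_mul_right (by linarith) hE₀
end

section
/- Let U and Y be real Hilbert spaces, S : U → Y a continuous linear map, g, y_d ∈ Y, λ ≥ 0, and let K ⊆ U be a nonempty, bounded, closed, convex set. Define J(u) := (1/2)‖S u + g − y_d‖²_Y + (λ/2)‖u‖²_U. Then there exists u* ∈ K such that J(u*) ≤ J(u) for all u ∈ K. -/
open RealInnerProductSpace

/-- A Hilbert space is reflexive. -/
theorem InnerProductSpace.inclusionInDoubleDual_surjective {E : Type*}
    [NormedAddCommGroup E] [InnerProductSpace ℝ E] [CompleteSpace E] :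
    Function.Surjective (NormedSpace.inclusionInDoubleDual ℝ E) := by
  intro φ
  refine ⟨(InnerProductSpace.toDual ℝ E).symm
    (φ ∘L (InnerProductSpace.toDualMap ℝ E).toContinuousLinearMap), ?_⟩
  ext f
  obtain ⟨y, rfl⟩ := (InnerProductSpace.toDual ℝ E).surjective f
  rw [NormedSpace.dual_def, InnerProductSpace.toDual_apply_apply, real_inner_comm,
    InnerProductSpace.toDual_symm_apply]
  rfl

/-- A closed convex set is weakly closed. -/
theorem Convex.isClosed_image_toWeakSpace {E : Type*} [NormedAddCommGroup E] [NormedSpace ℝ E]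
    {s : Set E} (hs : Convex ℝ s) (hc : IsClosed s) : IsClosed (toWeakSpace ℝ E '' s) := by
  rw [← closure_eq_iff_isClosed, ← hs.toWeakSpace_closure ℝ, hc.closure_eq]

/-- A bounded closed convex subset of a Hilbert space is weakly compact. -/
theorem Convex.isCompact_image_toWeakSpace {E : Type*}
    [NormedAddCommGroup E] [InnerProductSpace ℝ E] [CompleteSpace E]
    {s : Set E} (hs : Convex ℝ s) (hc : IsClosed s) (hb : Bornology.IsBounded s) :
    IsCompact (toWeakSpace ℝ E '' s) := by
  rw [← (hs.isClosed_image_toWeakSpace hc).closure_eq]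
  refine NormedSpace.isCompact_closure_of_isBounded ℝ E _ ?_ fun φ _ ↦ ?_
  · rwa [Set.preimage_image_eq _ (toWeakSpace ℝ E).injective]
  · obtain ⟨x, hx⟩ := InnerProductSpace.inclusionInDoubleDual_surjective (E := E)
      (StrongDual.toWeakDual.symm φ)
    exact ⟨toWeakSpace ℝ E x, congrArg StrongDual.toWeakDual hx⟩

/-- A quasiconvex lower semicontinuous function on a nonempty bounded closed convex subset of a
Hilbert space attains its minimum. -/
theorem QuasiconvexOn.exists_isMinOn {E : Type*}
    [NormedAddCommGroup E] [InnerProductSpace ℝ E] [CompleteSpace E]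
    {s : Set E} {f : E → ℝ} (hf : QuasiconvexOn ℝ s f) (hfc : LowerSemicontinuousOn f s)
    (hs : Convex ℝ s) (hne : s.Nonempty) (hc : IsClosed s) (hb : Bornology.IsBounded s) :
    ∃ x ∈ s, IsMinOn f s x := by
  have hlsc : LowerSemicontinuousOn (f ∘ (toWeakSpace ℝ E).symm) (toWeakSpace ℝ E '' s) := by
    rw [lowerSemicontinuousOn_iff_preimage_Iic] at hfc ⊢
    intro b
    have hclosed : IsClosed {x ∈ s | f x ≤ b} := by
      obtain ⟨v, hv, h⟩ := hfc b
      exact (h ▸ hc.inter hv : IsClosed (s ∩ f ⁻¹' Set.Iic b))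
    refine ⟨_, (hf b).isClosed_image_toWeakSpace hclosed, ?_⟩
    ext x
    obtain ⟨x, rfl⟩ := (toWeakSpace ℝ E).surjective x
    simp
  obtain ⟨_, ⟨x, hx, rfl⟩, hmin⟩ :=
    hlsc.exists_isMinOn (hne.image _) (hs.isCompact_image_toWeakSpace hc hb)
  exact ⟨x, hx, fun y hy ↦ by simpa using hmin (Set.mem_image_of_mem (toWeakSpace ℝ E) hy)⟩

theorem convexOn_univ_norm_sq {E : Type*} [NormedAddCommGroup E] [NormedSpace ℝ E] :
    ConvexOn ℝ Set.univ fun x : E ↦ ‖x‖ ^ 2 :=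
  (convexOn_norm convex_univ).pow (fun _ _ ↦ norm_nonneg _) 2

theorem stmt9 {U Y : Type*}
    [NormedAddCommGroup U] [InnerProductSpace ℝ U] [CompleteSpace U]
    [NormedAddCommGroup Y] [InnerProductSpace ℝ Y] [CompleteSpace Y]
    (S : U →L[ℝ] Y) (g yd : Y) (lam : ℝ) (hlam : 0 ≤ lam)
    (K : Set U) (hK : K.Nonempty) (hKb : Bornology.IsBounded K)
    (hKc : IsClosed K) (hKconv : Convex ℝ K)
    (J : U → ℝ)
    (hJ : ∀ u, J u = 1 / 2 * ‖S u + g - yd‖ ^ 2 + lam / 2 * ‖u‖ ^ 2) :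
    ∃ ustar ∈ K, ∀ u ∈ K, J ustar ≤ J u := by
  obtain rfl : J = fun u ↦ 1 / 2 * ‖S u + g - yd‖ ^ 2 + lam / 2 * ‖u‖ ^ 2 := funext hJ
  have htrack : ConvexOn ℝ Set.univ fun u ↦ ‖S u + g - yd‖ ^ 2 := by
    simpa [Function.comp_def, add_sub_assoc] using
      ((convexOn_univ_norm_sq (E := Y)).translate_left (g - yd)).comp_linearMap S.toLinearMap
  have hconv := (htrack.smul (c := 1 / 2) (by norm_num)).add
    ((convexOn_univ_norm_sq (E := U)).smul (c := lam / 2) (by positivity))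
  have hcont : Continuous fun u ↦ 1 / 2 * ‖S u + g - yd‖ ^ 2 + lam / 2 * ‖u‖ ^ 2 := by fun_prop
  exact (hconv.subset (Set.subset_univ K) hKconv).quasiconvexOn.exists_isMinOn
    (hcont.lowerSemicontinuous.lowerSemicontinuousOn K) hKconv hK hKc hKb
end

section
/- Let V be a real normed vector space, H a real Hilbert space, ι : V → H a continuous linear map, and a : V × V → ℝ a continuous symmetric bilinear form. Let τ > 0, T > 0, and let z : ℝ → H be continuous. Suppose: (i) y₁ : ℝ → V is twice continuously differentiable and u₁ : ℝ → H is continuous with τ⟨ι(y₁''(t)), ι(v)⟩_H + ⟨ι(y₁'(t)), ι(v)⟩_H + a(y₁(t), v) = ⟨u₁(t), ι(v)⟩_H for all t ∈ [0,T], v ∈ V; (ii) y₂ : ℝ → V is continuously differentiable and u₂ : ℝ → H is continuous with ⟨ι(y₂'(t)), ι(v)⟩_H + a(y₂(t), v) = ⟨u₂(t), ι(v)⟩_H for all t ∈ [0,T], v ∈ V; (iii) p₁ : ℝ → V is twice continuously differentiable with τ⟨ι(p₁''(t)), ι(v)⟩_H − ⟨ι(p₁'(t)), ι(v)⟩_H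 + a(p₁(t), v) = ⟨ι(y₁(t)) − z(t), ι(v)⟩_H for all t ∈ [0,T], v ∈ V; (iv) p₂ : ℝ → V is continuously differentiable with −⟨ι(p₂'(t)), ι(v)⟩_H + a(p₂(t), v) = ⟨ι(y₂(t)) − z(t), ι(v)⟩_H for all t ∈ [0,T], v ∈ V; and (v) y₁(0) = y₂(0) and p₁(T) = p₂(T). Then ∫₀ᵀ ‖ι(y₁(t) − y₂(t))‖²_H dt − ∫₀ᵀ ⟨u₁(t) − u₂(t), ι(p₁(t) − p₂(t))⟩_H dt = τ ∫₀ᵀ ( ⟨ι(p₁''(t)), ι(y₁(t) − y₂(t))⟩_H − ⟨ι(y₁''(t)), ι(p₁(t) − p₂(t))⟩_H ) dt. -/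
open MeasureTheory RealInnerProductSpace

theorem stmt13 {V : Type*} [NormedAddCommGroup V] [NormedSpace ℝ V]
    {H : Type*} [NormedAddCommGroup H] [InnerProductSpace ℝ H] [CompleteSpace H]
    (ι : V →L[ℝ] H) (a : V →L[ℝ] V →L[ℝ] ℝ)
    (hsymm : ∀ v w : V, a v w = a w v)
    (τ T : ℝ) (hτ : 0 < τ) (hT : 0 < T) (z : ℝ → H) (hz : Continuous z)
    (y₁ y₁' y₁'' : ℝ → V) (u₁ : ℝ → H)
    (hy₁ : ContDiff ℝ 2 y₁) (hy₁' : ∀ t, HasDerivAt y₁ (y₁' t) t)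
    (hy₁'' : ∀ t, HasDerivAt y₁' (y₁'' t) t) (hu₁ : Continuous u₁)
    (heq₁ : ∀ t ∈ Set.Icc (0 : ℝ) T, ∀ v : V,
      τ * ⟪ι (y₁'' t), ι v⟫ + ⟪ι (y₁' t), ι v⟫ + a (y₁ t) v = ⟪u₁ t, ι v⟫)
    (y₂ y₂' : ℝ → V) (u₂ : ℝ → H)
    (hy₂ : ContDiff ℝ 1 y₂) (hy₂' : ∀ t, HasDerivAt y₂ (y₂' t) t) (hu₂ : Continuous u₂)
    (heq₂ : ∀ t ∈ Set.Icc (0 : ℝ) T, ∀ v : V,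
      ⟪ι (y₂' t), ι v⟫ + a (y₂ t) v = ⟪u₂ t, ι v⟫)
    (p₁ p₁' p₁'' : ℝ → V)
    (hp₁ : ContDiff ℝ 2 p₁) (hp₁' : ∀ t, HasDerivAt p₁ (p₁' t) t)
    (hp₁'' : ∀ t, HasDerivAt p₁' (p₁'' t) t)
    (heqp₁ : ∀ t ∈ Set.Icc (0 : ℝ) T, ∀ v : V,
      τ * ⟪ι (p₁'' t), ι v⟫ - ⟪ι (p₁' t), ι v⟫ + a (p₁ t) v = ⟪ι (y₁ t) - z t, ι v⟫)
    (p₂ p₂' : ℝ → V)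
    (hp₂ : ContDiff ℝ 1 p₂) (hp₂' : ∀ t, HasDerivAt p₂ (p₂' t) t)
    (heqp₂ : ∀ t ∈ Set.Icc (0 : ℝ) T, ∀ v : V,
      -⟪ι (p₂' t), ι v⟫ + a (p₂ t) v = ⟪ι (y₂ t) - z t, ι v⟫)
    (hinit : y₁ 0 = y₂ 0) (hfinal : p₁ T = p₂ T) :
    (∫ t in (0 : ℝ)..T, ‖ι (y₁ t - y₂ t)‖ ^ 2)
      - (∫ t in (0 : ℝ)..T, ⟪u₁ t - u₂ t, ι (p₁ t - p₂ t)⟫) =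
    τ * ∫ t in (0 : ℝ)..T,
      (⟪ι (p₁'' t), ι (y₁ t - y₂ t)⟫ - ⟪ι (y₁'' t), ι (p₁ t - p₂ t)⟫) := by
  have cy₁ : Continuous y₁' := by
    rw [← deriv_eq hy₁']
    exact hy₁.continuous_deriv one_le_two
  have cy₂ : Continuous y₂' := by
    rw [← deriv_eq hy₂']
    exact hy₂.continuous_deriv le_rfl
  have cp₁ : Continuous p₁' := by
    rw [← deriv_eq hp₁']
    exact hp₁.continuous_deriv one_le_two
  have cp₂ : Continuous p₂' := by
    rw [← deriv_eq hp₂']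
    exact hp₂.continuous_deriv le_rfl
  have hy₁c := hy₁.continuous
  have hy₂c := hy₂.continuous
  have hp₁c := hp₁.continuous
  have hp₂c := hp₂.continuous
  have boundary : ∫ t in (0 : ℝ)..T, (⟪ι (y₁ t - y₂ t), ι (p₁' t - p₂' t)⟫
      + ⟪ι (y₁' t - y₂' t), ι (p₁ t - p₂ t)⟫) = 0 := by
    rw [intervalIntegral.integral_eq_sub_of_hasDerivAt
      (f := fun t => ⟪ι (y₁ t - y₂ t), ι (p₁ t - p₂ t)⟫)]
    · simp [hinit, hfinal]
    · intro t _
      exact (ι.hasFDerivAt.comp_hasDerivAt t ((hy₁' t).sub (hy₂' t))).inner ℝ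
        (ι.hasFDerivAt.comp_hasDerivAt t ((hp₁' t).sub (hp₂' t)))
    · exact Continuous.intervalIntegrable (by fun_prop) _ _
  rw [← intervalIntegral.integral_const_mul, ← intervalIntegral.integral_sub
    (Continuous.intervalIntegrable (by fun_prop) _ _)
    (Continuous.intervalIntegrable (by fun_prop) _ _)]
  refine (add_zero _).symm.trans ((congrArg (HAdd.hAdd _) boundary.symm).trans ?_)
  rw [← intervalIntegral.integral_add
    (Continuous.intervalIntegrable (by fun_prop) _ _)
    (Continuous.intervalIntegrable (by fun_prop) _ _)]
  refine intervalIntegral.integral_congr fun t ht => ?_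
  rw [Set.uIcc_of_le hT.le] at ht
  have state₁ := heq₁ t ht (p₁ t - p₂ t)
  have state₂ := heq₂ t ht (p₁ t - p₂ t)
  have adjoint₁ := heqp₁ t ht (y₁ t - y₂ t)
  have adjoint₂ := heqp₂ t ht (y₁ t - y₂ t)
  have symm₁ := hsymm (y₁ t - y₂ t) (p₁ t - p₂ t)
  have norm_sq : ‖ι (y₁ t - y₂ t)‖ ^ 2
      = ⟪ι (y₁ t) - z t, ι (y₁ t - y₂ t)⟫ - ⟪ι (y₂ t) - z t, ι (y₁ t - y₂ t)⟫ := by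
    rw [← inner_sub_left, sub_sub_sub_cancel_right, ← map_sub, real_inner_self_eq_norm_sq]
  have comm := real_inner_comm (ι (y₁ t - y₂ t)) (ι (p₁' t - p₂' t))
  have expand_p : ⟪ι (p₁' t - p₂' t), ι (y₁ t - y₂ t)⟫
      = ⟪ι (p₁' t), ι (y₁ t - y₂ t)⟫ - ⟪ι (p₂' t), ι (y₁ t - y₂ t)⟫ := by
    rw [map_sub ι (p₁' t), inner_sub_left]
  have expand_y : ⟪ι (y₁' t - y₂' t), ι (p₁ t - p₂ t)⟫
      = ⟪ι (y₁' t), ι (p₁ t - p₂ t)⟫ - ⟪ι (y₂' t), ι (p₁ t - p₂ t)⟫ := by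
    rw [map_sub ι (y₁' t), inner_sub_left]
  have expand_a : a (y₁ t - y₂ t) (p₁ t - p₂ t)
      = a (y₁ t) (p₁ t - p₂ t) - a (y₂ t) (p₁ t - p₂ t) := by
    rw [map_sub a, sub_apply]
  have expand_a' : a (p₁ t - p₂ t) (y₁ t - y₂ t)
      = a (p₁ t) (y₁ t - y₂ t) - a (p₂ t) (y₁ t - y₂ t) := by
    rw [map_sub a, sub_apply]
  have expand_u := inner_sub_left (𝕜 := ℝ) (u₁ t) (u₂ t) (ι (p₁ t - p₂ t))
  linarith
end
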